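/- arXiv:2209.10264 — 2 statements merged into one kernel-verified Lean document; each statement's English description precedes it below -/
import Mathlib

section
/- (Δ–Y transformation) Let G be a finite connected weighted graph containing a triangle on vertices x, y, z with edge resistances R_a (between y and z), R_b (between x and z) and R_c (between x and y). Let G' be obtained from G by deleting these three edges and adding a new vertex o joined to x, y, z by edges of resistances R_1 = R_bR_c/(R_a+R_b+R_c), R_2 = R_aR_c/(R_a+R_b+R_c) and R_3 = R_aR_b/(R_a+R_b+R_c) respectively. Then for all vertices a, b of G, the effective resistance is unchanged: r_{G'}(a,b) = r_G(a,b). -/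
/-!  Common definitions: Moore–Penrose pseudoinverse, resistance distance and
Kirchhoff index of a simple graph (unit resistors), weighted electrical networks
(given by a symmetric conductance function), multigraph electrical networks,
and the octagonal chains `O(w)`.  -/

/-- `M` is a Moore–Penrose pseudoinverse of `A`. -/
def Matrix.IsMoorePenroseInv {n : Type} [Fintype n] (A M : Matrix n n ℝ) : Prop :=
  A * M * A = A ∧ M * A * M = M ∧ (A * M).transpose = A * M ∧ (M * A).transpose = M * A

open Classical in
/-- The Moore–Penrose pseudoinverse of a real square matrix (it exists and is
unique; defined by choice). -/
noncomputable def mpinv {n : Type} [Fintype n] (A : Matrix n n ℝ) : Matrix n n ℝ :=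
  if h : ∃ M, A.IsMoorePenroseInv M then h.choose else 0

open Classical in
/-- The (real) Laplacian matrix of a simple graph: degree diagonal minus adjacency. -/
noncomputable def glap {V : Type} [Fintype V] (G : SimpleGraph V) : Matrix V V ℝ :=
  fun u v =>
    if u = v then ((Finset.univ.filter (fun t => G.Adj u t)).card : ℝ)
    else if G.Adj u v then -1 else 0

/-- Resistance distance `r_G(u,v) = (e_u - e_v)ᵀ L⁺ (e_u - e_v)` in a simple graph,
each edge being a unit resistor. -/
noncomputable def resDist {V : Type} [Fintype V] (G : SimpleGraph V) (u v : V) : ℝ :=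
  mpinv (glap G) u u - mpinv (glap G) u v - mpinv (glap G) v u + mpinv (glap G) v v

/-- `r_G(a)`: the sum of the resistance distances between `a` and all other vertices. -/
noncomputable def resSum {V : Type} [Fintype V] [DecidableEq V] (G : SimpleGraph V) (a : V) : ℝ :=
  ∑ b ∈ Finset.univ.erase a, resDist G a b

/-- The Kirchhoff index: the sum of resistance distances over all unordered pairs. -/
noncomputable def kirchhoff {V : Type} [Fintype V] (G : SimpleGraph V) : ℝ :=
  (∑ u, ∑ v, resDist G u v) / 2

/-- A weighted graph (electrical network) on `V`, recorded by its symmetric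
conductance function: `cond u v` is the reciprocal of the resistance of the edge
`uv` (and `0` if there is no such edge). -/
structure Network (V : Type) where
  cond : V → V → ℝ
  symm : ∀ u v, cond u v = cond v u
  nonneg : ∀ u v, 0 ≤ cond u v
  loopless : ∀ v, cond v v = 0

/-- The weighted Laplacian of a network. -/
noncomputable def Network.lap {V : Type} [Fintype V] [DecidableEq V] (N : Network V) :
    Matrix V V ℝ :=
  fun u v => if u = v then ∑ t, N.cond u t else -N.cond u v

/-- Effective resistance in a network, via the pseudoinverse of the weighted Laplacian. -/
noncomputable def Network.effRes {V : Type} [Fintype V] [DecidableEq V] (N : Network V)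
    (u v : V) : ℝ :=
  mpinv N.lap u u - mpinv N.lap u v - mpinv N.lap v u + mpinv N.lap v v

/-- The underlying simple graph of a network. -/
def Network.toGraph {V : Type} (N : Network V) : SimpleGraph V :=
  SimpleGraph.fromRel (fun u v => N.cond u v ≠ 0)

/-- An electrical network with multiple edges allowed: a finite edge type, each edge a
non-loop with two endpoints and a positive resistance. -/
structure MultiNetwork (V : Type) where
  E : Type
  [fE : Fintype E]
  ends : E → Sym2 V
  not_loop : ∀ e, ¬ (ends e).IsDiag
  res : E → ℝ
  res_pos : ∀ e, 0 < res e

attribute [instance] MultiNetwork.fE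

/-- Total conductance between `u` and `v`: the sum, over all edges joining `u` and `v`,
of the reciprocals of their resistances. -/
noncomputable def MultiNetwork.cond {V : Type} [DecidableEq V] (M : MultiNetwork V)
    (u v : V) : ℝ :=
  ∑ e ∈ Finset.univ.filter (fun e => M.ends e = s(u, v)), (M.res e)⁻¹

/-- The weighted Laplacian of a multigraph network. -/
noncomputable def MultiNetwork.lap {V : Type} [Fintype V] [DecidableEq V]
    (M : MultiNetwork V) : Matrix V V ℝ :=
  fun u v => if u = v then ∑ t, M.cond u t else -M.cond u v

/-- Effective resistance in a multigraph network. -/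
noncomputable def MultiNetwork.effRes {V : Type} [Fintype V] [DecidableEq V]
    (M : MultiNetwork V) (u v : V) : ℝ :=
  mpinv M.lap u u - mpinv M.lap u v - mpinv M.lap v u + mpinv M.lap v v

/-- The underlying simple graph of a multigraph network. -/
def MultiNetwork.toGraph {V : Type} (M : MultiNetwork V) : SimpleGraph V :=
  SimpleGraph.fromRel (fun u v => ∃ e, M.ends e = s(u, v))

/-!  The octagonal chain `O(w)` with `n` octagons, `w = (w_1, …, w_{n-2})`,
`w_i ∈ {0,1,2,3,4}`.  Its `6n+2` vertices are laid out along the outer boundary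
cycle `0, 1, …, 6n+1`: position `0` is the top-left corner, the top boundary runs
rightwards (the top of the octagon `H_i`, `1 ≤ i ≤ n-2`, carries `w_i` inserted
vertices), then the right vertical edge, then the bottom boundary runs leftwards
back to the bottom-left corner `6n+1`.  The graph is this outer cycle together
with the `n-1` chords `t_k b_k` shared by consecutive octagons. -/

/-- Boundary position of the top vertex `t_k` (`1 ≤ k ≤ n-1`) of the `k`-th shared
vertical edge: `t_k = k + w_1 + ⋯ + w_{k-1}`. -/
def tpos (n : ℕ) (w : Fin (n - 2) → Fin 5) (k : ℕ) : ℕ :=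
  k + ∑ j ∈ Finset.univ.filter (fun j : Fin (n - 2) => (j : ℕ) + 1 < k), ((w j : ℕ))

/-- Boundary position of the bottom vertex `b_k` (`1 ≤ k ≤ n-1`) of the `k`-th shared
vertical edge: `b_k = n + (w_1 + ⋯ + w_{n-2}) + 6 + Σ_{j ≥ k} (5 - w_j)`. -/
def bpos (n : ℕ) (w : Fin (n - 2) → Fin 5) (k : ℕ) : ℕ :=
  n + (∑ j, ((w j : ℕ))) + 6 +
    ∑ j ∈ Finset.univ.filter (fun j : Fin (n - 2) => k ≤ (j : ℕ) + 1), (5 - ((w j : ℕ)))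

/-- The octagonal chain `O(w)` with `n` octagons: the outer boundary cycle on
`6n+2` vertices together with the chords `t_k b_k`, `k = 1, …, n-1`. -/
def octChain (n : ℕ) (w : Fin (n - 2) → Fin 5) : SimpleGraph (Fin (6 * n + 2)) :=
  SimpleGraph.fromRel (fun a b =>
    ((a : ℕ) + 1 = (b : ℕ)) ∨ ((a : ℕ) = 6 * n + 1 ∧ (b : ℕ) = 0) ∨
    ∃ k, 1 ≤ k ∧ k ≤ n - 1 ∧ (a : ℕ) = tpos n w k ∧ (b : ℕ) = bpos n w k)

theorem exists_mp {n : Type} [Fintype n] [DecidableEq n] (A : Matrix n n ℝ) (hA : A.IsHermitian) :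
    ∃ M, A.IsMoorePenroseInv M := by
  have hs := hA.spectral_theorem
  set φ := Unitary.conjStarAlgAut ℝ (Matrix n n ℝ) hA.eigenvectorUnitary with hφ
  set d : n → ℝ := hA.eigenvalues with hd
  have hs' : A = φ (Matrix.diagonal d) := hs
  have ht : ∀ B : Matrix n n ℝ, B.transpose = star B := by
    intro B
    ext i j
    simp [Matrix.star_apply]
  have hm : ∀ f g : n → ℝ, φ (Matrix.diagonal f) * φ (Matrix.diagonal g)
      = φ (Matrix.diagonal (fun i => f i * g i)) := by
    intro f g
    rw [← map_mul, Matrix.diagonal_mul_diagonal]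
  have hst : ∀ f : n → ℝ, (φ (Matrix.diagonal f)).transpose = φ (Matrix.diagonal f) := by
    intro f
    rw [ht, ← map_star]
    congr 1
    rw [← ht, Matrix.diagonal_transpose]
  refine ⟨φ (Matrix.diagonal (fun i => (d i)⁻¹)), ?_, ?_, ?_, ?_⟩
  · rw [hs', hm, hm]
    congr 2
    funext i
    by_cases h : d i = 0 <;> simp [h]
  · rw [hs', hm, hm]
    congr 2
    funext i
    by_cases h : d i = 0 <;> simp [h]
  · rw [hs', hm, hst]
  · rw [hs', hm, hst]

theorem Network.lap_symm {V : Type} [Fintype V] [DecidableEq V] (N : Network V) :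
    N.lap.transpose = N.lap := by
  ext i j
  simp only [Matrix.transpose_apply, Network.lap]
  by_cases h : i = j
  · subst h; rfl
  · rw [if_neg h, if_neg (Ne.symm h), N.symm]

theorem Network.mp {V : Type} [Fintype V] [DecidableEq V] (N : Network V) :
    N.lap.IsMoorePenroseInv (mpinv N.lap) := by
  have h : ∃ M, N.lap.IsMoorePenroseInv M := by
    apply exists_mp
    have := N.lap_symm
    rw [Matrix.IsHermitian, Matrix.conjTranspose_eq_transpose_of_trivial]
    exact this
  unfold mpinv
  rw [dif_pos h]
  exact h.choose_spec

theorem Network.lap_mulVec {V : Type} [Fintype V] [DecidableEq V] (N : Network V) (v : V → ℝ)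
    (u : V) : (N.lap.mulVec v) u = ∑ t, N.cond u t * (v u - v t) := by
  have h1 : ∀ t, N.lap u t * v t =
      (if u = t then (∑ s, N.cond u s) * v u else 0) - N.cond u t * v t := by
    intro t
    unfold Network.lap
    by_cases h : u = t
    · subst h; simp [N.loopless]
    · simp [h]
  simp only [Matrix.mulVec, dotProduct]
  rw [Finset.sum_congr rfl (fun t _ => h1 t), Finset.sum_sub_distrib]
  simp only [Finset.sum_ite_eq, Finset.mem_univ, if_true, mul_sub, Finset.sum_sub_distrib,
    Finset.sum_mul]

theorem Network.effRes_eq {V : Type} [Fintype V] [DecidableEq V] (N : Network V) (a b : V)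
    (v : V → ℝ) (hv : N.lap.mulVec v = Pi.single a 1 - Pi.single b 1) :
    N.effRes a b = v a - v b := by
  have h1 := N.mp.1
  have h2 : N.effRes a b = (Pi.single a 1 - Pi.single b 1 : V → ℝ) ⬝ᵥ
      ((mpinv N.lap).mulVec (Pi.single a 1 - Pi.single b 1)) := by
    simp only [Network.effRes, Matrix.mulVec_sub, sub_dotProduct, dotProduct_sub,
      Matrix.mulVec_single_one, single_one_dotProduct, Matrix.col_apply]
    ring
  have h3 : (Pi.single a 1 - Pi.single b 1 : V → ℝ) = Matrix.vecMul v N.lap := by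
    rw [← hv, ← Matrix.vecMul_transpose, N.lap_symm]
  have h4 : (Pi.single a 1 - Pi.single b 1 : V → ℝ) ⬝ᵥ
      ((mpinv N.lap).mulVec (Pi.single a 1 - Pi.single b 1))
      = v ⬝ᵥ (Pi.single a 1 - Pi.single b 1) := by
    conv_lhs => rw [h3, ← Matrix.dotProduct_mulVec, ← h3, ← hv, Matrix.mulVec_mulVec,
      Matrix.mulVec_mulVec, h1, hv]
  rw [h2, h4]
  simp [dotProduct_sub]

theorem Network.ker_const {V : Type} [Fintype V] [DecidableEq V] (N : Network V)
    (hconn : N.toGraph.Connected) (w : V → ℝ) (hw : N.lap.mulVec w = 0) (a b : V) :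
    w a = w b := by
  have h0 : ∑ u, w u * ∑ t, N.cond u t * (w u - w t) = 0 := by
    apply Finset.sum_eq_zero
    intro u _
    rw [← N.lap_mulVec, hw]; simp
  have hA : ∑ u, ∑ t, N.cond u t * (w u * (w u - w t)) = 0 := by
    rw [← h0]
    refine Finset.sum_congr rfl fun u _ => ?_
    rw [Finset.mul_sum]
    refine Finset.sum_congr rfl fun t _ => ?_
    ring
  have hB : ∑ u, ∑ t, N.cond u t * (w t * (w t - w u)) = 0 := by
    rw [Finset.sum_comm, ← hA]
    refine Finset.sum_congr rfl fun u _ => Finset.sum_congr rfl fun t _ => ?_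
    rw [N.symm]
  have hC : ∑ u, ∑ t, N.cond u t * (w u - w t) ^ 2 = 0 := by
    have : ∑ u, ∑ t, N.cond u t * (w u - w t) ^ 2
        = ∑ u, ∑ t, N.cond u t * (w u * (w u - w t))
          + ∑ u, ∑ t, N.cond u t * (w t * (w t - w u)) := by
      rw [← Finset.sum_add_distrib]
      refine Finset.sum_congr rfl fun u _ => ?_
      rw [← Finset.sum_add_distrib]
      refine Finset.sum_congr rfl fun t _ => ?_
      ring
    rw [this, hA, hB, add_zero]
  have hnn : ∀ u t, 0 ≤ N.cond u t * (w u - w t) ^ 2 := fun u t =>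
    mul_nonneg (N.nonneg u t) (sq_nonneg _)
  have hz : ∀ u t, N.cond u t * (w u - w t) ^ 2 = 0 := by
    intro u t
    have h1 := (Finset.sum_eq_zero_iff_of_nonneg
      (fun u _ => Finset.sum_nonneg fun t _ => hnn u t)).1 hC u (Finset.mem_univ u)
    exact (Finset.sum_eq_zero_iff_of_nonneg (fun t _ => hnn u t)).1 h1 t (Finset.mem_univ t)
  have hadj : ∀ u t, N.toGraph.Adj u t → w u = w t := by
    intro u t h
    have hc : N.cond u t ≠ 0 := by
      rw [Network.toGraph, SimpleGraph.fromRel_adj] at h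
      rcases h.2 with h | h
      · exact h
      · rwa [N.symm]
    have := (mul_eq_zero.1 (hz u t)).resolve_left hc
    have := pow_eq_zero_iff (two_ne_zero) |>.1 this
    linarith
  obtain ⟨p⟩ := hconn.preconnected a b
  induction p with
  | nil => rfl
  | cons h _ ih => exact (hadj _ _ h).trans ih

theorem Network.exists_potential {V : Type} [Fintype V] [DecidableEq V] (N : Network V)
    (hconn : N.toGraph.Connected) (a b : V) :
    ∃ v : V → ℝ, N.lap.mulVec v = Pi.single a 1 - Pi.single b 1 := by
  obtain ⟨h1, -, h3, -⟩ := N.mp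
  set L := N.lap with hL
  set M := mpinv L with hM
  set e : V → ℝ := Pi.single a 1 - Pi.single b 1 with he
  refine ⟨M.mulVec e, ?_⟩
  set w : V → ℝ := e - (L * M).mulVec e with hwdef
  have hLP : L * (L * M) = L := by
    have := congrArg Matrix.transpose h1
    rw [Matrix.transpose_mul, h3, N.lap_symm] at this
    exact this
  have hPP : (L * M) * (L * M) = L * M := by
    rw [← mul_assoc, h1]
  have hLw : L.mulVec w = 0 := by
    rw [hwdef, Matrix.mulVec_sub, Matrix.mulVec_mulVec, hLP, sub_self]
  have hPw : (L * M).mulVec w = 0 := by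
    rw [hwdef, Matrix.mulVec_sub, Matrix.mulVec_mulVec, hPP, sub_self]
  have hwe : w ⬝ᵥ e = 0 := by
    rw [he, dotProduct_sub]
    simp [N.ker_const hconn w hLw a b]
  have hww : w ⬝ᵥ w = 0 := by
    have : w ⬝ᵥ (L * M).mulVec e = 0 := by
      rw [Matrix.dotProduct_mulVec, ← h3, Matrix.vecMul_transpose, hPw, zero_dotProduct]
    conv_lhs => rw [hwdef]
    rw [← hwdef]
    change w ⬝ᵥ (e - (L * M).mulVec e) = 0
    rw [dotProduct_sub, hwe, this, sub_self]
  have hw0 : w = 0 := dotProduct_self_eq_zero.1 hww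
  rw [Matrix.mulVec_mulVec]
  exact (sub_eq_zero.1 hw0).symm

/-- Δ–Y transformation. Replacing a triangle on `x, y, z` with edge
resistances `R_a` (between `y,z`), `R_b` (between `x,z`), `R_c` (between `x,y`) by a new
vertex `o` joined to `x, y, z` by edges of resistances `R_bR_c/(R_a+R_b+R_c)`,
`R_aR_c/(R_a+R_b+R_c)`, `R_aR_b/(R_a+R_b+R_c)` leaves all effective resistances between
the original vertices unchanged. -/
theorem deltaY_transformation {V : Type} [Fintype V] [DecidableEq V] (N : Network V)
    (hconn : N.toGraph.Connected)
    (x y z : V) (hxy : x ≠ y) (hyz : y ≠ z) (hxz : x ≠ z)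
    (Ra Rb Rc : ℝ) (hRa : 0 < Ra) (hRb : 0 < Rb) (hRc : 0 < Rc)
    (ha : N.cond y z = Ra⁻¹) (hb : N.cond x z = Rb⁻¹) (hc : N.cond x y = Rc⁻¹)
    (N' : Network (V ⊕ Unit))
    (hold : ∀ a b : V, N'.cond (Sum.inl a) (Sum.inl b) =
      if (a = x ∧ b = y) ∨ (a = y ∧ b = x) ∨ (a = y ∧ b = z) ∨ (a = z ∧ b = y) ∨
         (a = x ∧ b = z) ∨ (a = z ∧ b = x) then 0 else N.cond a b)
    (hnx : N'.cond (Sum.inl x) (Sum.inr ()) = (Rb * Rc / (Ra + Rb + Rc))⁻¹)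
    (hny : N'.cond (Sum.inl y) (Sum.inr ()) = (Ra * Rc / (Ra + Rb + Rc))⁻¹)
    (hnz : N'.cond (Sum.inl z) (Sum.inr ()) = (Ra * Rb / (Ra + Rb + Rc))⁻¹)
    (hother : ∀ a : V, a ≠ x → a ≠ y → a ≠ z → N'.cond (Sum.inl a) (Sum.inr ()) = 0) :
    ∀ a b : V, N'.effRes (Sum.inl a) (Sum.inl b) = N.effRes a b := by
  intro a b
  obtain ⟨v, hv⟩ := N.exists_potential hconn a b
  rw [N.effRes_eq a b v hv]
  have hx0 := hRa.ne'
  have hy0 := hRb.ne'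
  have hz0 := hRc.ne'
  have hS : Ra + Rb + Rc ≠ 0 := by positivity
  set o : ℝ := (Ra * v x + Rb * v y + Rc * v z) / (Ra + Rb + Rc) with ho
  refine N'.effRes_eq (Sum.inl a) (Sum.inl b) (Sum.elim v (fun _ => o)) ?_
  have hsplit : ∀ p : V, ∀ f : V → ℝ, ∑ t, f t * (if t = p then 1 else 0) = f p := by
    intro p f; simp
  have key : ∀ u, ∑ t, N'.cond (Sum.inl u) (Sum.inl t) * (v u - v t)
      + N'.cond (Sum.inl u) (Sum.inr ()) * (v u - o) = ∑ t, N.cond u t * (v u - v t) := by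
    have aux : ∀ u p q : V, p ≠ q → (∀ t, N'.cond (Sum.inl u) (Sum.inl t) =
        if t = p ∨ t = q then 0 else N.cond u t) →
        ∑ t, N'.cond (Sum.inl u) (Sum.inl t) * (v u - v t)
          = ∑ t, N.cond u t * (v u - v t) - N.cond u p * (v u - v p)
            - N.cond u q * (v u - v q) := by
      intro u p q hpq h
      rw [← hsplit p (fun t => N.cond u t * (v u - v t)),
        ← hsplit q (fun t => N.cond u t * (v u - v t)), ← Finset.sum_sub_distrib,
        ← Finset.sum_sub_distrib]
      refine Finset.sum_congr rfl fun t _ => ?_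
      rw [h]
      by_cases h1 : t = p
      · subst h1; simp [hpq]
      · by_cases h2 : t = q
        · subst h2; simp [h1]
        · simp [h1, h2]
    intro u
    by_cases h1 : u = x
    · subst h1
      rw [aux u y z hyz (by intro t; rw [hold]; simp [hxy, hxz]), hnx, hc, hb, ho]
      field_simp
      ring
    by_cases h2 : u = y
    · subst h2
      rw [aux u x z hxz (by intro t; rw [hold]; simp [hxy.symm, hyz]), hny, N.symm u x, hc, ha, ho]
      field_simp
      ring
    by_cases h3 : u = z
    · subst h3
      rw [aux u x y hxy (by intro t; rw [hold]; simp [hxz.symm, hyz.symm, or_comm]), hnz,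
        N.symm u x, N.symm u y, hb, ha, ho]
      field_simp
      ring
    · rw [hother u h1 h2 h3, zero_mul, add_zero]
      refine Finset.sum_congr rfl fun t _ => ?_
      rw [hold]; simp [h1, h2, h3]
  funext u
  rw [N'.lap_mulVec, Fintype.sum_sum_type]
  rcases u with u | u
  · simp only [Sum.elim_inl, Sum.elim_inr, Finset.univ_unique, Finset.sum_singleton]
    have hu := congrFun hv u
    rw [N.lap_mulVec, ← key u] at hu
    refine Eq.trans hu ?_
    simp [Pi.single_apply]
  · have hz : ∀ t, N'.cond (Sum.inr u) (Sum.inl t) * (o - v t) =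
        ((Rb * Rc / (Ra + Rb + Rc))⁻¹ * (o - v t)) * (if t = x then 1 else 0)
        + ((Ra * Rc / (Ra + Rb + Rc))⁻¹ * (o - v t)) * (if t = y then 1 else 0)
        + ((Ra * Rb / (Ra + Rb + Rc))⁻¹ * (o - v t)) * (if t = z then 1 else 0) := by
      intro t
      rw [N'.symm]
      by_cases h1 : t = x
      · subst h1; rw [hnx]; simp [hxy, hxz]
      by_cases h2 : t = y
      · subst h2; rw [hny]; simp [hxy.symm, hyz]
      by_cases h3 : t = z
      · subst h3; rw [hnz]; simp [hxz.symm, hyz.symm]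
      · rw [hother t h1 h2 h3]; simp [h1, h2, h3]
    simp only [Sum.elim_inl, Sum.elim_inr, sub_self, mul_zero, Finset.sum_const_zero, add_zero]
    rw [Finset.sum_congr rfl (fun t _ => hz t), Finset.sum_add_distrib, Finset.sum_add_distrib,
      hsplit, hsplit, hsplit, ho]
    simp only [Pi.sub_apply, Pi.single_apply, reduceCtorEq, if_false, sub_self]
    field_simp
    ring
end

section
/- Let O(w) be an octagonal chain with n octagons (n ≥ 3) and w = (w_1,...,w_{n−2}), and suppose that for some index i ∈ {1,...,n−2} one has w_i = 0 or w_i = 4. Let w' = (w_1,...,w_{i−1}, 2, 4−w_{i+1},...,4−w_{n−2}). Then Kf(O(w)) < Kf(O(w')). -/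
namespace Oct

open Classical in
noncomputable def lp {V : Type} [Fintype V] (G : SimpleGraph V) (f : V → ℝ) (x : V) : ℝ :=
  ∑ y, if G.Adj x y then f x - f y else 0

open Classical in
noncomputable def ee {V : Type} (u x : V) : ℝ := if x = u then 1 else 0

section
variable {V : Type} [Fintype V]

set_option linter.unusedSectionVars false

lemma ee_self (u : V) : ee u u = 1 := by simp [ee]
lemma ee_ne {u x : V} (h : x ≠ u) : ee u x = 0 := by simp [ee, h]

lemma sum_ee (u : V) (f : V → ℝ) : ∑ x, ee u x * f x = f u := by
  classical
  simp [ee]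

lemma glap_mulVec (G : SimpleGraph V) (f : V → ℝ) : (glap G).mulVec f = lp G f := by
  classical
  funext x
  have h1 : ∀ y, glap G x y * f y =
      (if y = x then ((Finset.univ.filter (fun t => G.Adj x t)).card : ℝ) * f x else 0)
        - (if G.Adj x y then f y else 0) := by
    intro y
    unfold glap
    by_cases h : x = y
    · subst h; simp
    · rw [if_neg h, if_neg (Ne.symm h)]
      by_cases h' : G.Adj x y <;> simp [h']
  have h2 : ∀ y, (if G.Adj x y then f x - f y else 0) =
      (if G.Adj x y then f x else 0) - (if G.Adj x y then f y else 0) := by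
    intro y; split_ifs <;> simp
  simp only [Matrix.mulVec, dotProduct, lp]
  rw [Finset.sum_congr rfl (fun y _ => h1 y), Finset.sum_congr rfl (fun y _ => h2 y)]
  rw [Finset.sum_sub_distrib, Finset.sum_sub_distrib]
  congr 1
  rw [Finset.sum_ite_eq', ← Finset.sum_filter]
  simp

lemma glap_symm (G : SimpleGraph V) : (glap G).transpose = glap G := by
  classical
  ext u v
  simp only [Matrix.transpose_apply, glap]
  by_cases h : u = v
  · subst h; rfl
  · rw [if_neg h, if_neg (Ne.symm h), G.adj_comm]

lemma exists_mp (A : Matrix V V ℝ) (hA : A.transpose = A) : ∃ M, A.IsMoorePenroseInv M := by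
  classical
  have hH : A.IsHermitian := by
    rw [Matrix.IsHermitian, Matrix.conjTranspose_eq_transpose_of_trivial, hA]
  obtain ⟨U, d, hU, hUA⟩ : ∃ (U : Matrix V V ℝ) (d : V → ℝ), U.transpose * U = 1 ∧
      A = U * Matrix.diagonal d * U.transpose := by
    refine ⟨hH.eigenvectorUnitary, hH.eigenvalues, ?_, ?_⟩
    · have := (Matrix.mem_unitaryGroup_iff'.mp hH.eigenvectorUnitary.2)
      rwa [Matrix.star_eq_conjTranspose, Matrix.conjTranspose_eq_transpose_of_trivial] at this
    · have := hH.spectral_theorem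
      rw [Unitary.conjStarAlgAut_apply] at this
      rw [← Matrix.conjTranspose_eq_transpose_of_trivial]
      exact this
  have key : ∀ a b : V → ℝ, (U * Matrix.diagonal a * U.transpose) *
      (U * Matrix.diagonal b * U.transpose)
      = U * Matrix.diagonal (fun i => a i * b i) * U.transpose := by
    intro a b
    calc _ = U * Matrix.diagonal a * (U.transpose * U) * Matrix.diagonal b * U.transpose := by
            simp only [Matrix.mul_assoc]
      _ = _ := by
            rw [hU, Matrix.mul_one, Matrix.mul_assoc U, Matrix.diagonal_mul_diagonal]
  have tr : ∀ a : V → ℝ, (U * Matrix.diagonal a * U.transpose).transpose =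
      U * Matrix.diagonal a * U.transpose := by
    intro a
    simp [Matrix.transpose_mul, Matrix.mul_assoc]
  refine ⟨U * Matrix.diagonal (fun i => (d i)⁻¹) * U.transpose, ?_, ?_, ?_, ?_⟩
  · rw [hUA, key, key]
    congr 3; funext i
    by_cases h : d i = 0 <;> simp [h]
  · rw [hUA, key, key]
    congr 3; funext i
    by_cases h : d i = 0 <;> simp [h]
  · rw [hUA, key, tr]
  · rw [hUA, key, tr]

lemma mp_spec (G : SimpleGraph V) : glap G * mpinv (glap G) * glap G = glap G := by
  have h := exists_mp (glap G) (glap_symm G)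
  have : (glap G).IsMoorePenroseInv (mpinv (glap G)) := by
    unfold mpinv
    rw [dif_pos h]
    exact h.choose_spec
  exact this.1

lemma maxprin (H : SimpleGraph V) (S : Set V) (p : V) (hp : p ∈ S) (f : V → ℝ)
    (h : ∀ x ∈ S, x ≠ p → (∀ y, H.Adj x y → y ∈ S) ∧ lp H f x ≤ 0)
    (hr : ∀ x ∈ S, H.Reachable x p) : ∀ x ∈ S, f x ≤ f p := by
  classical
  obtain ⟨m, hmS, hm⟩ := Set.exists_max_image S f (Set.toFinite S) ⟨p, hp⟩
  have key : ∀ (x y : V) (_ : H.Walk x y), y = p → x ∈ S → (∀ z ∈ S, f z ≤ f x) →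
      ∀ z ∈ S, f z ≤ f p := by
    intro x y wk
    induction wk with
    | nil => rintro rfl _ hx; exact hx
    | @cons a b c hab _ ih =>
      intro hc haS hmax
      by_cases hap : a = p
      · rw [← hap]; exact hmax
      · obtain ⟨h1, h2⟩ := h a haS hap
        have hnn : ∀ y ∈ Finset.univ, (0:ℝ) ≤ if H.Adj a y then f a - f y else 0 := by
          intro y _
          split_ifs with hy
          · linarith [hmax y (h1 y hy)]
          · exact le_rfl
        have hle : (if H.Adj a b then f a - f b else 0) ≤ lp H f a :=
          Finset.single_le_sum hnn (Finset.mem_univ b)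
        rw [if_pos hab] at hle
        refine ih hc (h1 b hab) (fun z hz => ?_)
        linarith [hmax z hz]
  obtain ⟨wk⟩ := hr m hmS
  exact key m p wk rfl hmS hm

lemma lp_zero_const (H : SimpleGraph V) (f : V → ℝ) (h : ∀ x, lp H f x = 0) (u v : V)
    (huv : H.Reachable u v) : f u = f v := by
  have key : ∀ p q, H.Reachable q p → f q ≤ f p := by
    intro p q hqp
    refine maxprin H {x | H.Reachable x p} p (SimpleGraph.Reachable.refl p) f ?_ (fun x hx => hx)
      q hqp
    intro x hx _
    refine ⟨fun y hy => ?_, (h x).le⟩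
    exact (hy.symm.reachable).trans hx
  exact le_antisymm (key v u huv) (key u v huv.symm)

lemma exists_pot (H : SimpleGraph V) (u v : V) (huv : H.Reachable u v) :
    ∃ g : V → ℝ, ∀ x, lp H g x = ee u x - ee v x := by
  classical
  set L := glap H with hL
  set M := mpinv L with hM
  have hs : L * M * L = L := mp_spec H
  have hT : L.transpose = L := glap_symm H
  have h0 : L * (1 - M * L) = 0 := by
    rw [Matrix.mul_sub, Matrix.mul_one, ← Matrix.mul_assoc, hs, sub_self]
  have hcol : ∀ y, (1 - M * L) u y = (1 - M * L) v y := by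
    intro y
    refine lp_zero_const H (fun x => (1 - M * L) x y) (fun x => ?_) u v huv
    rw [← glap_mulVec]
    exact congrFun (congrFun h0 x) y
  have ht : (1 - M * L).transpose = 1 - L * M.transpose := by
    rw [Matrix.transpose_sub, Matrix.transpose_mul, hT, Matrix.transpose_one]
  refine ⟨fun x => M u x - M v x, fun x => ?_⟩
  rw [← glap_mulVec]
  have h1 := hcol x
  simp only [Matrix.sub_apply, Matrix.mul_apply, Matrix.one_apply] at h1
  simp only [Matrix.mulVec, dotProduct, ← hL, mul_sub, Finset.sum_sub_distrib]
  have h2 : ∀ a, ∑ z, L x z * M a z = ∑ z, M a z * L z x := by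
    intro a
    refine Finset.sum_congr rfl fun z _ => ?_
    have : L x z = L z x := congrFun (congrFun hT z) x
    rw [this, mul_comm]
  rw [h2, h2]
  simp only [ee, @eq_comm _ x]
  linarith

lemma lp_adj (G : SimpleGraph V) (f g : V → ℝ) : ∑ x, f x * lp G g x = ∑ x, lp G f x * g x := by
  have h1 : f ⬝ᵥ (glap G).mulVec g = (glap G).mulVec f ⬝ᵥ g := by
    rw [Matrix.dotProduct_mulVec, ← Matrix.mulVec_transpose, glap_symm]
  rw [glap_mulVec, glap_mulVec] at h1
  exact h1

lemma pot_diff (G : SimpleGraph V) (u v : V) (g f : V → ℝ)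
    (hg : ∀ x, lp G g x = ee u x - ee v x) : ∑ x, lp G f x * g x = f u - f v := by
  rw [← lp_adj]
  simp only [hg, mul_sub, Finset.sum_sub_distrib]
  rw [← sum_ee u f, ← sum_ee v f]
  simp only [mul_comm]

lemma resDist_eq (G : SimpleGraph V) (u v : V) (g : V → ℝ)
    (hg : ∀ x, lp G g x = ee u x - ee v x) : resDist G u v = g u - g v := by
  classical
  set L := glap G with hL
  set M := mpinv L with hM
  have hs : L * M * L = L := mp_spec G
  have hT : L.transpose = L := glap_symm G
  have hLg : L.mulVec g = fun x => ee u x - ee v x := by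
    rw [hL, glap_mulVec]; funext x; exact hg x
  have h1 : resDist G u v = (L.mulVec g) ⬝ᵥ M.mulVec (L.mulVec g) := by
    rw [hLg]
    have : ∀ x, M.mulVec (fun x => ee u x - ee v x) x = M x u - M x v := by
      intro x
      simp only [Matrix.mulVec, dotProduct, mul_sub, Finset.sum_sub_distrib]
      rw [← sum_ee u (M x), ← sum_ee v (M x)]
      simp only [mul_comm]
    simp only [dotProduct, this, sub_mul, Finset.sum_sub_distrib, sum_ee]
    simp only [resDist, ← hL, ← hM]
    ring
  have h2 : (L.mulVec g) ⬝ᵥ M.mulVec (L.mulVec g) = g ⬝ᵥ L.mulVec g := by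
    have : (L.mulVec g) = Matrix.vecMul g L := by
      rw [← Matrix.mulVec_transpose, hT]
    nth_rewrite 1 [this]
    rw [← Matrix.dotProduct_mulVec, Matrix.mulVec_mulVec, Matrix.mulVec_mulVec, hs]
  rw [h1, h2, hLg]
  simp only [dotProduct, mul_sub, Finset.sum_sub_distrib]
  rw [← sum_ee u g, ← sum_ee v g]
  simp only [mul_comm]

lemma kirchhoff_comap (G : SimpleGraph V) (hG : G.Preconnected) (σ : V ≃ V) :
    kirchhoff (G.comap σ) = kirchhoff G := by
  classical
  have h : ∀ u v, resDist (G.comap σ) u v = resDist G (σ u) (σ v) := by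
    intro u v
    obtain ⟨g, hg⟩ := exists_pot G (σ u) (σ v) (hG _ _)
    rw [resDist_eq G _ _ g hg, resDist_eq (G.comap σ) u v (fun x => g (σ x))]
    intro x
    have := hg (σ x)
    simp only [lp, ee, SimpleGraph.comap_adj, σ.injective.eq_iff] at this ⊢
    rw [← this]
    exact Equiv.sum_comp σ (fun y => if G.Adj (σ x) y then g (σ x) - g y else 0)
  unfold kirchhoff
  congr 1
  rw [← Equiv.sum_comp σ (fun u => ∑ v, resDist G u v)]
  refine Finset.sum_congr rfl fun u _ => ?_
  rw [← Equiv.sum_comp σ (fun v => resDist G (σ u) v)]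
  exact Finset.sum_congr rfl fun v _ => h u v

lemma lp_sup_edge (H : SimpleGraph V) (u v : V) (huv : u ≠ v) (hn : ¬ H.Adj u v) (f : V → ℝ)
    (x : V) : lp (H ⊔ SimpleGraph.edge u v) f x =
      lp H f x + (f u - f v) * (ee u x - ee v x) := by
  classical
  have h1 : ∀ y, (if (H ⊔ SimpleGraph.edge u v).Adj x y then f x - f y else 0) =
      (if H.Adj x y then f x - f y else 0) + (ee v y * (ee u x * (f u - f v))
        + ee u y * (ee v x * (f v - f u))) := by
    intro y
    have hn' : ¬ H.Adj v u := fun h => hn h.symm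
    simp only [SimpleGraph.sup_adj, SimpleGraph.edge_adj, ee]
    by_cases h1 : x = u <;> by_cases h2 : x = v <;> by_cases h3 : y = u <;> by_cases h4 : y = v <;>
      simp_all
  simp only [lp]
  refine (Finset.sum_congr rfl (fun y _ => by convert h1 y)).trans ?_
  rw [Finset.sum_add_distrib, Finset.sum_add_distrib, sum_ee v (fun _ => ee u x * (f u - f v)), sum_ee u (fun _ => ee v x * (f v - f u))]
  ring

lemma algebra_main (G G' : SimpleGraph V) (hG : G.Preconnected) (p1 p2 q1 q2 : V)
    (φ ψ : V → ℝ) (α β : ℝ)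
    (h2 : ∀ f x, lp G' f x = lp G f x + (ee p1 x - ee p2 x) * (f q1 - f q2)
      + (ee q1 x - ee q2 x) * (f p1 - f p2))
    (hφ : ∀ x, lp G φ x = (1 + α) * (ee p1 x - ee p2 x) - α * (ee q1 x - ee q2 x))
    (hψ : ∀ x, lp G ψ x = (1 + β) * (ee q1 x - ee q2 x) - β * (ee p1 x - ee p2 x))
    (hφp : φ p1 - φ p2 = 2 * α) (hφq : φ q1 - φ q2 = 0)
    (hψq : ψ q1 - ψ q2 = 2 * β) (hψp : ψ p1 - ψ p2 = 0)
    (hz : ∀ x, φ x * ψ x = 0) (hpos : 0 < 1 + α + β)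
    (hsφ : 0 < ∑ x, φ x) (hsψ : 0 < ∑ x, ψ x) : kirchhoff G < kirchhoff G' := by
  have hd : ∀ u v, resDist G' u v =
      resDist G u v - 2 / (1 + α + β) * ((φ u - φ v) * (ψ u - ψ v)) := by
    intro u v
    obtain ⟨g, hg⟩ := exists_pot G u v (hG u v)
    have e1 := pot_diff G u v g φ hg
    have e2 := pot_diff G u v g ψ hg
    have hs : ∀ a b c d : V, ∀ A B : ℝ, ∑ x, (A * (ee a x - ee b x) - B * (ee c x - ee d x)) * g x
        = A * (g a - g b) - B * (g c - g d) := by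
      intro a b c d A B
      rw [← sum_ee a g, ← sum_ee b g, ← sum_ee c g, ← sum_ee d g]
      simp only [← Finset.sum_sub_distrib, Finset.mul_sum]
      exact Finset.sum_congr rfl fun x _ => by ring
    simp only [hφ, hs] at e1
    simp only [hψ, hs] at e2
    set s := g p1 - g p2
    set t := g q1 - g q2
    set D := 1 + α + β with hD
    have hD0 : D ≠ 0 := hpos.ne'
    -- g' = g - t σ - s τ
    rw [resDist_eq G u v g hg, resDist_eq G' u v
      (fun x => g x + ((-(t * (1 + β)) + s * β) / D) * φ x + ((t * α - s * (1 + α)) / D) * ψ x)]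
    · have hF : φ u - φ v = (1 + α) * s - α * t := e1.symm
      have hP : ψ u - ψ v = (1 + β) * t - β * s := e2.symm
      have : ∀ A B : ℝ, g u + A * φ u + B * ψ u - (g v + A * φ v + B * ψ v)
        = g u - g v + A * (φ u - φ v) + B * (ψ u - ψ v) := by intros; ring
      rw [this, hF, hP]
      field_simp
      rw [hD]
      ring
    · intro x
      have lin : ∀ (A B : ℝ), lp G (fun x => g x + A * φ x + B * ψ x) x
          = lp G g x + A * lp G φ x + B * lp G ψ x := by
        intro A B
        simp only [← glap_mulVec, Matrix.mulVec, dotProduct, Finset.mul_sum,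
          ← Finset.sum_add_distrib]
        exact Finset.sum_congr rfl fun y _ => by ring
      rw [h2, lin, hφ, hψ, hg]
      have l1 : ∀ A B : ℝ, g q1 + A * φ q1 + B * ψ q1 - (g q2 + A * φ q2 + B * ψ q2)
          = t + B * (2 * β) := by
        intro A B
        rw [← hψq]; linear_combination A * hφq
      have l2 : ∀ A B : ℝ, g p1 + A * φ p1 + B * ψ p1 - (g p2 + A * φ p2 + B * ψ p2)
          = s + A * (2 * α) := by
        intro A B
        rw [← hφp]; linear_combination B * hψp
      rw [l1, l2]
      field_simp
      rw [hD]
      ring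
  have hsum : ∑ u, ∑ v, (φ u - φ v) * (ψ u - ψ v) = - 2 * ((∑ x, φ x) * (∑ x, ψ x)) := by
    have : ∀ u v, (φ u - φ v) * (ψ u - ψ v) = - (φ u * ψ v) - φ v * ψ u := by
      intro u v; linear_combination hz u + hz v
    simp only [this, Finset.sum_sub_distrib, Finset.sum_neg_distrib]
    have a1 : ∑ u, ∑ v, φ u * ψ v = (∑ x, φ x) * ∑ x, ψ x := by
      rw [Finset.sum_mul_sum]
    have a2 : ∑ u, ∑ v, φ v * ψ u = (∑ x, φ x) * ∑ x, ψ x := by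
      rw [Finset.sum_comm, Finset.sum_mul_sum]
    rw [a1, a2]; ring
  unfold kirchhoff
  simp only [hd, Finset.sum_sub_distrib, ← Finset.mul_sum, hsum]
  have : 0 < 2 / (1 + α + β) * (2 * ((∑ x, φ x) * (∑ x, ψ x))) := by positivity
  linarith

structure Half (H : SimpleGraph V) (A : Finset V) (a1 a2 m1 m2 : V) : Prop where
  ha1 : a1 ∈ A
  ha2 : a2 ∈ A
  hm1 : m1 ∉ A
  hm2 : m2 ∉ A
  h12 : m1 ≠ m2
  hcl : ∀ x ∈ A, ∀ y, H.Adj x y → y ∈ A ∨ (x = a2 ∧ y = m1)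
  hm1n : ∀ y, H.Adj m1 y ↔ y = a2 ∨ y = m2
  hm2n : ∀ y, H.Adj m2 y ↔ y = m1
  hadj : H.Adj a1 a2
  hr : ∀ x ∈ A, H.Reachable x a1
  hcard : 8 ≤ A.card

lemma half_pot (H : SimpleGraph V) (A : Finset V) (a1 a2 m1 m2 : V) (h : Half H A a1 a2 m1 m2) :
    ∃ (φ : V → ℝ) (α : ℝ), 0 ≤ α ∧ (∀ x, ¬ (x ∈ A ∨ x = m1 ∨ x = m2) → φ x = 0) ∧
      (∀ x, lp H φ x = ee a1 x - ee m2 x) ∧ φ a1 = α ∧ φ m2 = -α ∧ 0 < ∑ x, φ x := by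
  classical
  have ham : H.Adj m1 a2 := (h.hm1n a2).2 (Or.inl rfl)
  have hmm : H.Adj m2 m1 := (h.hm2n m1).2 rfl
  have r1 : H.Reachable m1 a1 := ham.reachable.trans (h.hr a2 h.ha2)
  have r2 : H.Reachable m2 a1 := hmm.reachable.trans r1
  obtain ⟨g, hg⟩ := exists_pot H a1 m2 r2.symm
  have n1 : a1 ≠ m1 := fun e => h.hm1 (e ▸ h.ha1)
  have n2 : a1 ≠ m2 := fun e => h.hm2 (e ▸ h.ha1)
  have n3 : a2 ≠ m1 := fun e => h.hm1 (e ▸ h.ha2)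
  have n4 : a2 ≠ m2 := fun e => h.hm2 (e ▸ h.ha2)
  set P : V → Prop := fun x => x ∈ A ∨ x = m1 ∨ x = m2 with hP
  have cl : ∀ x y, H.Adj x y → P x → P y := by
    rintro x y hxy (hx | rfl | rfl)
    · rcases h.hcl x hx y hxy with h' | ⟨_, h'⟩
      · exact Or.inl h'
      · exact Or.inr (Or.inl h')
    · rcases (h.hm1n y).1 hxy with rfl | rfl
      · exact Or.inl h.ha2
      · exact Or.inr (Or.inr rfl)
    · exact Or.inr (Or.inl ((h.hm2n y).1 hxy))
  set c := (g a1 + g m2) / 2 with hc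
  set φ : V → ℝ := fun x => if P x then g x - c else 0 with hφ
  have lpφ : ∀ x, lp H φ x = ee a1 x - ee m2 x := by
    intro x
    by_cases hx : P x
    · rw [← hg x]
      unfold lp
      refine Finset.sum_congr rfl fun y _ => ?_
      by_cases hxy : H.Adj x y
      · rw [if_pos hxy, if_pos hxy]
        simp only [hφ, if_pos hx, if_pos (cl x y hxy hx)]
        ring
      · rw [if_neg hxy, if_neg hxy]
    · rw [ee_ne, ee_ne, sub_self]
      · unfold lp
        refine Finset.sum_eq_zero fun y _ => ?_
        by_cases hxy : H.Adj x y
        · rw [if_pos hxy]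
          have : ¬ P y := fun hy => hx (cl y x hxy.symm hy)
          simp only [hφ, if_neg hx, if_neg this, sub_self]
        · rw [if_neg hxy]
      · rintro rfl; exact hx (Or.inr (Or.inr rfl))
      · rintro rfl; exact hx (Or.inl h.ha1)
  have va1 : φ a1 = (g a1 - g m2) / 2 := by
    simp only [hφ, if_pos (show P a1 from Or.inl h.ha1)]; rw [hc]; ring
  have vm2 : φ m2 = -((g a1 - g m2) / 2) := by
    simp only [hφ, if_pos (show P m2 from Or.inr (Or.inr rfl))]; rw [hc]; ring
  set α := (g a1 - g m2) / 2 with hα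
  have em2 : φ m2 - φ m1 = -1 := by
    have := lpφ m2
    rw [ee_self, ee_ne n2.symm] at this
    unfold lp at this
    simp only [h.hm2n] at this
    simpa using this
  have em1 : (φ m1 - φ a2) + (φ m1 - φ m2) = 0 := by
    have := lpφ m1
    rw [ee_ne n1.symm, ee_ne h.h12] at this
    unfold lp at this
    simp only [h.hm1n] at this
    rw [← Finset.sum_filter] at this
    have e : (Finset.univ.filter fun y => y = a2 ∨ y = m2) = {a2, m2} := by
      ext y; simp
    rw [e, Finset.sum_pair n4] at this
    linarith
  have mx : ∀ x, P x → φ x ≤ φ a1 := by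
    refine maxprin H {x | P x} a1 (Or.inl h.ha1) φ ?_ ?_
    · intro x hx hne
      refine ⟨fun y hy => cl x y hy hx, ?_⟩
      rw [lpφ, ee_ne hne]
      unfold ee
      split_ifs <;> norm_num
    · rintro x (hx | rfl | rfl)
      · exact h.hr x hx
      · exact r1
      · exact r2
  have mn : ∀ x ∈ A, -φ x ≤ -φ a2 := by
    refine maxprin H {x | x ∈ A} a2 h.ha2 (fun x => -φ x) ?_ ?_
    · intro x hx hne
      refine ⟨fun y hy => ?_, ?_⟩
      · rcases h.hcl x hx y hy with h' | ⟨h', _⟩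
        · exact h'
        · exact absurd h' hne
      · have e : lp H (fun x => -φ x) x = - lp H φ x := by
          unfold lp
          rw [← Finset.sum_neg_distrib]
          refine Finset.sum_congr rfl fun y _ => ?_
          split_ifs <;> ring
        have hne2 : x ≠ m2 := fun e => h.hm2 (e ▸ hx)
        rw [e, lpφ, ee_ne hne2]
        unfold ee
        split_ifs <;> norm_num
    · intro x hx
      exact (h.hr x hx).trans (h.hr a2 h.ha2).symm
  have e12 : φ a1 - φ a2 ≤ 1 := by
    have hnn : ∀ y ∈ Finset.univ, (0:ℝ) ≤ if H.Adj a1 y then φ a1 - φ y else 0 := by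
      intro y _
      split_ifs with hy
      · linarith [mx y (cl a1 y hy (Or.inl h.ha1))]
      · exact le_rfl
    have hle : (if H.Adj a1 a2 then φ a1 - φ a2 else 0) ≤ lp H φ a1 :=
      Finset.single_le_sum hnn (Finset.mem_univ a2)
    rw [if_pos h.hadj, lpφ, ee_self, ee_ne n2] at hle
    linarith
  have m21 := mx a2 (Or.inl h.ha2)
  refine ⟨φ, α, by linarith, fun x hx => if_neg hx, lpφ, va1, vm2, ?_⟩
  have hsum : ∑ x, φ x = ∑ x ∈ insert m1 (insert m2 A), φ x := by
    symm
    refine Finset.sum_subset (Finset.subset_univ _) fun x _ hx => ?_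
    have : ¬ P x := by
      intro hp
      apply hx
      simp only [Finset.mem_insert]
      rcases hp with hp | hp | hp <;> tauto
    simp only [hφ, if_neg this]
  rw [hsum, Finset.sum_insert (by simp [h.h12, h.hm1]), Finset.sum_insert h.hm2]
  have hA : (A.card : ℝ) * φ a2 ≤ ∑ x ∈ A, φ x := by
    rw [← nsmul_eq_mul]
    exact Finset.card_nsmul_le_sum A φ (φ a2) (fun x hx => by linarith [mn x hx])
  have hc8 : (8:ℝ) ≤ A.card := by exact_mod_cast h.hcard
  have : 8 * φ a2 ≤ (A.card : ℝ) * φ a2 := by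
    apply mul_le_mul_of_nonneg_right hc8
    linarith
  linarith

lemma switch (H G G' : SimpleGraph V) (hG : G.Preconnected) (A B : Finset V)
    (a1 a2 m1 m2 b1 b2 m4 m3 : V) (hA : Half H A a1 a2 m1 m2) (hB : Half H B b1 b2 m4 m3)
    (hd : ∀ x, (x ∈ A ∨ x = m1 ∨ x = m2) → (x ∈ B ∨ x = m4 ∨ x = m3) → False)
    (hGe : G = H ⊔ SimpleGraph.edge a1 b1 ⊔ SimpleGraph.edge m2 m3)
    (hGe' : G' = H ⊔ SimpleGraph.edge a1 m3 ⊔ SimpleGraph.edge m2 b1) :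
    kirchhoff G < kirchhoff G' := by
  obtain ⟨φ, α, hα, hφ0, hφl, hφ1, hφ2, hφs⟩ := half_pot H A a1 a2 m1 m2 hA
  obtain ⟨ψ, β, hβ, hψ0, hψl, hψ1, hψ2, hψs⟩ := half_pot H B b1 b2 m4 m3 hB
  have pa1 : a1 ∈ A ∨ a1 = m1 ∨ a1 = m2 := Or.inl hA.ha1
  have pm2 : m2 ∈ A ∨ m2 = m1 ∨ m2 = m2 := Or.inr (Or.inr rfl)
  have pm1 : m1 ∈ A ∨ m1 = m1 ∨ m1 = m2 := Or.inr (Or.inl rfl)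
  have qb1 : b1 ∈ B ∨ b1 = m4 ∨ b1 = m3 := Or.inl hB.ha1
  have qm3 : m3 ∈ B ∨ m3 = m4 ∨ m3 = m3 := Or.inr (Or.inr rfl)
  have x1 : a1 ≠ b1 := fun e => hd a1 pa1 (e ▸ qb1)
  have x2 : m2 ≠ m3 := fun e => hd m2 pm2 (e ▸ qm3)
  have x3 : a1 ≠ m3 := fun e => hd a1 pa1 (e ▸ qm3)
  have x4 : m2 ≠ b1 := fun e => hd m2 pm2 (e ▸ qb1)
  have x5 : a1 ≠ m2 := fun e => hA.hm2 (e ▸ hA.ha1)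
  have y1 : ∀ z, (z ∈ B ∨ z = m4 ∨ z = m3) → ¬ H.Adj a1 z := by
    intro z hz ha
    rcases hA.hcl a1 hA.ha1 z ha with h | ⟨_, h⟩
    · exact hd z (Or.inl h) hz
    · exact hd z (Or.inr (Or.inl h)) hz
  have y2 : ∀ z, (z ∈ B ∨ z = m4 ∨ z = m3) → ¬ H.Adj m2 z := by
    intro z hz ha
    exact hd z (Or.inr (Or.inl ((hA.hm2n z).1 ha))) hz
  have L1 : ∀ f x, lp G f x = lp H f x + (f a1 - f b1) * (ee a1 x - ee b1 x)
      + (f m2 - f m3) * (ee m2 x - ee m3 x) := by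
    intro f x
    rw [hGe, lp_sup_edge _ _ _ x2, lp_sup_edge _ _ _ x1 (y1 _ qb1)]
    simp only [SimpleGraph.sup_adj, SimpleGraph.edge_adj]
    rintro (h | ⟨⟨h, _⟩ | ⟨h, _⟩, _⟩)
    · exact y2 _ qm3 h
    · exact x5 h.symm
    · exact x4 h
  have L2 : ∀ f x, lp G' f x = lp H f x + (f a1 - f m3) * (ee a1 x - ee m3 x)
      + (f m2 - f b1) * (ee m2 x - ee b1 x) := by
    intro f x
    rw [hGe', lp_sup_edge _ _ _ x4, lp_sup_edge _ _ _ x3 (y1 _ qm3)]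
    simp only [SimpleGraph.sup_adj, SimpleGraph.edge_adj]
    rintro (h | ⟨⟨h, _⟩ | ⟨h, _⟩, _⟩)
    · exact y2 _ qb1 h
    · exact x5 h.symm
    · exact x2 h
  have φb1 : φ b1 = 0 := hφ0 b1 (fun h => hd _ h qb1)
  have φm3 : φ m3 = 0 := hφ0 m3 (fun h => hd _ h qm3)
  have ψa1 : ψ a1 = 0 := hψ0 a1 (fun h => hd _ pa1 h)
  have ψm2 : ψ m2 = 0 := hψ0 m2 (fun h => hd _ pm2 h)
  refine algebra_main G G' hG a1 m2 b1 m3 φ ψ α β ?_ ?_ ?_ ?_ ?_ ?_ ?_ ?_ ?_ hφs hψs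
  · intro f x; rw [L1, L2]; ring
  · intro x; rw [L1, hφl, hφ1, hφ2, φb1, φm3]; ring
  · intro x; rw [L1, hψl, hψ1, hψ2, ψa1, ψm2]; ring
  · rw [hφ1, hφ2]; ring
  · rw [φb1, φm3]; ring
  · rw [hψ1, hψ2]; ring
  · rw [ψa1, ψm2]; ring
  · intro x
    by_cases hx : x ∈ A ∨ x = m1 ∨ x = m2
    · rw [hψ0 x (fun h => hd x hx h), mul_zero]
    · rw [hφ0 x hx, zero_mul]
  · linarith

end

def Gg (N : ℕ) (C : ℕ → ℕ → Prop) : SimpleGraph (Fin N) :=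
  SimpleGraph.fromRel (fun a b => ((a : ℕ) + 1 = (b : ℕ)) ∨ ((a : ℕ) + 1 = N ∧ (b : ℕ) = 0) ∨ C a b)

def Hg (N : ℕ) (C : ℕ → ℕ → Prop) (l r : ℕ) : SimpleGraph (Fin N) :=
  SimpleGraph.fromRel (fun a b => ((a : ℕ) + 1 = (b : ℕ) ∧ (b : ℕ) ≠ l ∧ (a : ℕ) ≠ r) ∨
    ((a : ℕ) + 1 = N ∧ (b : ℕ) = 0) ∨ C a b)

lemma Gg_adj {N : ℕ} {C : ℕ → ℕ → Prop} (x y : Fin N) : (Gg N C).Adj x y ↔ (x : ℕ) ≠ y ∧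
    (((x : ℕ) + 1 = y ∨ (y : ℕ) + 1 = x ∨ ((x : ℕ) + 1 = N ∧ (y : ℕ) = 0) ∨
      ((y : ℕ) + 1 = N ∧ (x : ℕ) = 0)) ∨ (C x y ∨ C y x)) := by
  simp only [Gg, SimpleGraph.fromRel_adj, ne_eq, Fin.ext_iff]
  tauto

lemma Hg_adj {N : ℕ} {C : ℕ → ℕ → Prop} {l r : ℕ} (x y : Fin N) :
    (Hg N C l r).Adj x y ↔ (x : ℕ) ≠ y ∧
    ((((x : ℕ) + 1 = y ∧ (y : ℕ) ≠ l ∧ (x : ℕ) ≠ r) ∨ ((y : ℕ) + 1 = x ∧ (x : ℕ) ≠ l ∧ (y : ℕ) ≠ r)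
      ∨ ((x : ℕ) + 1 = N ∧ (y : ℕ) = 0) ∨
      ((y : ℕ) + 1 = N ∧ (x : ℕ) = 0)) ∨ (C x y ∨ C y x)) := by
  simp only [Hg, SimpleGraph.fromRel_adj, ne_eq, Fin.ext_iff]
  tauto

lemma reach_seg {N : ℕ} (H : SimpleGraph (Fin N)) (a : ℕ) (ha : a < N) (d : ℕ) (hb : a + d < N)
    (h : ∀ (x y : Fin N), (x : ℕ) + 1 = y → a ≤ x → (x : ℕ) < a + d → H.Adj x y) :
    H.Reachable ⟨a, ha⟩ ⟨a + d, hb⟩ := by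
  induction d with
  | zero => exact SimpleGraph.Reachable.refl _
  | succ d ih =>
    have h1 := ih (by omega) (fun x y hxy h1 h2 => h x y hxy h1 (by omega))
    refine h1.trans (SimpleGraph.Adj.reachable (h _ _ ?_ ?_ ?_))
    · show a + d + 1 = a + (d + 1)
      omega
    · show a ≤ a + d
      omega
    · show a + d < a + (d + 1)
      omega

lemma reach_seg' {N : ℕ} (H : SimpleGraph (Fin N)) (a b : Fin N) (hab : (a : ℕ) ≤ b)
    (h : ∀ (x y : Fin N), (x : ℕ) + 1 = y → (a : ℕ) ≤ x → (x : ℕ) < b → H.Adj x y) :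
    H.Reachable a b := by
  have := reach_seg H a a.2 (b - a) (by omega) (fun x y h0 h1 h2 => h x y h0 h1 (by omega))
  have e : (⟨(a : ℕ) + (b - a), by omega⟩ : Fin N) = b := by
    apply Fin.ext; show (a : ℕ) + (b - a) = b; omega
  rwa [e] at this

lemma Gg_conn {N : ℕ} {C : ℕ → ℕ → Prop} : (Gg N C).Preconnected := by
  have key : ∀ a b : Fin N, (a : ℕ) ≤ b → (Gg N C).Reachable a b := by
    intro a b hab
    refine reach_seg' _ a b hab fun x y hxy _ _ => ?_
    rw [Gg_adj]
    exact ⟨by omega, Or.inl (Or.inl hxy)⟩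
  intro a b
  rcases le_total (a : ℕ) b with h | h
  · exact key a b h
  · exact (key b a h).symm

lemma Hg_in {N : ℕ} {C : ℕ → ℕ → Prop} {l r : ℕ} (x y : Fin N) (hx : l ≤ (x : ℕ) ∧ (x : ℕ) ≤ r)
    (hy : l ≤ (y : ℕ) ∧ (y : ℕ) ≤ r) : (Hg N C l r).Reachable x y := by
  have key : ∀ a b : Fin N, (a : ℕ) ≤ b → l ≤ (a : ℕ) → (b : ℕ) ≤ r →
      (Hg N C l r).Reachable a b := by
    intro a b hab h1 h2
    refine reach_seg' _ a b hab fun x y hxy _ _ => ?_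
    rw [Hg_adj]
    exact ⟨by omega, Or.inl (Or.inl ⟨hxy, by omega, by omega⟩)⟩
  rcases le_total (x : ℕ) y with h | h
  · exact key x y h hx.1 hy.2
  · exact (key y x h hy.1 hx.2).symm

lemma Hg_out {N : ℕ} {C : ℕ → ℕ → Prop} {l r : ℕ} (hN : 2 ≤ N) (hl : 1 ≤ l) (hlr : l < r)
    (hrN : r + 1 < N) (x y : Fin N)
    (hx : (x : ℕ) < l ∨ r < (x : ℕ)) (hy : (y : ℕ) < l ∨ r < (y : ℕ)) :
    (Hg N C l r).Reachable x y := by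
  have key : ∀ x : Fin N, ((x : ℕ) < l ∨ r < (x : ℕ)) →
      (Hg N C l r).Reachable x ⟨0, by omega⟩ := by
    intro x hx
    rcases hx with hx | hx
    · refine (reach_seg' _ ⟨0, by omega⟩ x (Nat.zero_le _) fun a b hab _ h2 => ?_).symm
      rw [Hg_adj]
      exact ⟨by omega, Or.inl (Or.inl ⟨hab, by omega, by omega⟩)⟩
    · have h1 : (Hg N C l r).Reachable x ⟨N - 1, by omega⟩ := by
        refine reach_seg' _ x ⟨N - 1, by omega⟩ (by show (x : ℕ) ≤ N - 1; omega)
          fun a b hab h1 h2 => ?_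
        rw [Hg_adj]
        exact ⟨by omega, Or.inl (Or.inl ⟨hab, by omega, by omega⟩)⟩
      refine h1.trans (SimpleGraph.Adj.reachable ?_)
      rw [Hg_adj]
      refine ⟨by show N - 1 ≠ 0; omega, Or.inl (Or.inr (Or.inr (Or.inl ⟨?_, rfl⟩)))⟩
      show N - 1 + 1 = N
      omega
  exact (key x hx).trans (key y hy).symm

lemma Gg_eq {N : ℕ} {C : ℕ → ℕ → Prop} {l r : ℕ} (hl : 1 ≤ l) (hlr : l < r) (hrN : r + 1 < N) :
    Gg N C = Hg N C l r ⊔ SimpleGraph.edge (⟨l - 1, by omega⟩ : Fin N) ⟨l, by omega⟩ ⊔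
      SimpleGraph.edge (⟨r, by omega⟩ : Fin N) ⟨r + 1, by omega⟩ := by
  ext x y
  simp only [SimpleGraph.sup_adj, SimpleGraph.edge_adj, Gg_adj, Hg_adj, ne_eq, Fin.ext_iff]
  generalize (C x y ∨ C y x) = c
  have hx := x.2
  have hy := y.2
  by_cases hc : c <;> simp only [hc, or_true, or_false, and_true] <;> omega

def rev (l r x : ℕ) : ℕ := if l ≤ x ∧ x ≤ r then l + r - x else x

lemma rev_rev (l r x : ℕ) : rev l r (rev l r x) = x := by
  unfold rev; split_ifs <;> omega

lemma rev_aux (N l r a b : ℕ) (c : Prop) (hl : 1 ≤ l) (hlr : l < r) (hrN : r + 1 < N)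
    (ha : a < N) (hb : b < N) :
    (¬rev l r a = rev l r b ∧ ((rev l r a + 1 = rev l r b ∨ rev l r b + 1 = rev l r a ∨
      rev l r a + 1 = N ∧ rev l r b = 0 ∨ rev l r b + 1 = N ∧ rev l r a = 0) ∨ c)) ↔
    ((¬a = b ∧ ((a + 1 = b ∧ ¬b = l ∧ ¬a = r ∨ b + 1 = a ∧ ¬a = l ∧ ¬b = r ∨
      a + 1 = N ∧ b = 0 ∨ b + 1 = N ∧ a = 0) ∨ c)) ∨
      (a = l - 1 ∧ b = r ∨ a = r ∧ b = l - 1) ∧ ¬a = b) ∨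
      (a = l ∧ b = r + 1 ∨ a = r + 1 ∧ b = l) ∧ ¬a = b := by
  have h0 : rev l r a = rev l r b ↔ a = b :=
    ⟨fun h => by rw [← rev_rev l r a, h, rev_rev], fun h => by rw [h]⟩
  have ra : (l ≤ a ∧ a ≤ r ∧ rev l r a + a = l + r) ∨ ((a < l ∨ r < a) ∧ rev l r a = a) := by
    unfold rev; split_ifs <;> omega
  have rb : (l ≤ b ∧ b ≤ r ∧ rev l r b + b = l + r) ∨ ((b < l ∨ r < b) ∧ rev l r b = b) := by
    unfold rev; split_ifs <;> omega
  rw [h0]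
  generalize rev l r a = a' at *
  generalize rev l r b = b' at *
  clear h0
  constructor
  · rintro ⟨hne, h | h⟩
    · rcases ra with ⟨u1, u2, u3⟩ | ⟨u1, u2⟩ <;> rcases rb with ⟨v1, v2, v3⟩ | ⟨v1, v2⟩
      · exact Or.inl (Or.inl ⟨hne, Or.inl (by omega)⟩)
      · rcases (show (a = l ∧ b = r + 1) ∨ (a = r ∧ b = l - 1) by omega) with h' | h'
        · exact Or.inr ⟨Or.inl h', hne⟩
        · exact Or.inl (Or.inr ⟨Or.inr h', hne⟩)
      · rcases (show (a = r + 1 ∧ b = l) ∨ (a = l - 1 ∧ b = r) by omega) with h' | h'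
        · exact Or.inr ⟨Or.inr h', hne⟩
        · exact Or.inl (Or.inr ⟨Or.inl h', hne⟩)
      · exact Or.inl (Or.inl ⟨hne, Or.inl (by omega)⟩)
    · exact Or.inl (Or.inl ⟨hne, Or.inr h⟩)
  · rintro ((⟨hne, h | h⟩ | ⟨h, hne⟩) | ⟨h, hne⟩)
    · refine ⟨hne, Or.inl ?_⟩
      rcases h with h | h | h | h <;> omega
    · exact ⟨hne, Or.inr h⟩
    · refine ⟨hne, Or.inl ?_⟩
      rcases h with h | h <;> omega
    · refine ⟨hne, Or.inl ?_⟩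
      rcases h with h | h <;> omega

def sg (N l r : ℕ) (h : r < N) : Fin N ≃ Fin N :=
  Function.Involutive.toPerm
    (fun x => ⟨rev l r x, by have := x.2; unfold rev; split_ifs <;> omega⟩)
    (fun x => Fin.ext (rev_rev l r x))

lemma sg_val (N l r : ℕ) (h : r < N) (x : Fin N) : ((sg N l r h x : Fin N) : ℕ) = rev l r x := rfl

lemma Gg_comap {N : ℕ} {C C' : ℕ → ℕ → Prop} {l r : ℕ} (hl : 1 ≤ l) (hlr : l < r) (hrN : r + 1 < N)
    (hC : ∀ x y, (C' (rev l r x) (rev l r y) ∨ C' (rev l r y) (rev l r x)) ↔ (C x y ∨ C y x)) :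
    (Gg N C').comap (sg N l r (by omega)) =
      Hg N C l r ⊔ SimpleGraph.edge (⟨l - 1, by omega⟩ : Fin N) ⟨r, by omega⟩ ⊔
      SimpleGraph.edge (⟨l, by omega⟩ : Fin N) ⟨r + 1, by omega⟩ := by
  ext x y
  simp only [SimpleGraph.comap_adj, SimpleGraph.sup_adj, SimpleGraph.edge_adj, Gg_adj, Hg_adj,
    ne_eq, Fin.ext_iff, sg_val, hC]
  generalize (C x y ∨ C y x) = c
  have hx := x.2
  have hy := y.2
  exact rev_aux N l r x y c hl hlr hrN hx hy

lemma card_fin (N : ℕ) (p : ℕ → Prop) [DecidablePred p] (S : Finset ℕ)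
    (hS : ∀ x ∈ S, x < N ∧ p x) : S.card ≤ (Finset.univ.filter fun x : Fin N => p x).card := by
  rw [← Finset.card_map (s := Finset.univ.filter fun x : Fin N => p x) Fin.valEmbedding]
  refine Finset.card_le_card fun x hx => ?_
  rw [Finset.mem_map]
  exact ⟨⟨x, (hS x hx).1⟩, by simpa using (hS x hx).2, rfl⟩

lemma card_out (N a b : ℕ) (hab : a ≤ b) (hb : b ≤ N) :
    a + (N - b) ≤ (Finset.univ.filter fun x : Fin N => (x : ℕ) < a ∨ b ≤ (x : ℕ)).card := by
  have := card_fin N (fun x => x < a ∨ b ≤ x) (Finset.range a ∪ Finset.Ico b N) (by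
    intro x hx
    simp only [Finset.mem_union, Finset.mem_range, Finset.mem_Ico] at hx
    omega)
  rwa [Finset.card_union_of_disjoint, Finset.card_range, Nat.card_Ico] at this
  rw [Finset.disjoint_left]
  intro x hx hy
  simp only [Finset.mem_range, Finset.mem_Ico] at hx hy
  omega

lemma card_in (N a b : ℕ) (hb : b < N) :
    b + 1 - a ≤ (Finset.univ.filter fun x : Fin N => a ≤ (x : ℕ) ∧ (x : ℕ) ≤ b).card := by
  have := card_fin N (fun x => a ≤ x ∧ x ≤ b) (Finset.Icc a b) (by
    intro x hx
    simp only [Finset.mem_Icc] at hx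
    omega)
  rwa [Nat.card_Icc] at this

lemma main0 (N : ℕ) (C C' : ℕ → ℕ → Prop) (l r : ℕ) (hl : 1 ≤ l)
    (hrN : r + 3 < N) (hcA : 8 ≤ l + (N - (r + 3))) (hcB : l + 9 ≤ r)
    (hC1 : ∀ x y, C x y → (x + 1 ≤ l ∧ r + 3 ≤ y) ∨ (l ≤ x ∧ y + 2 ≤ r ∧ x < y))
    (hC2 : C (l - 1) (r + 3)) (hC3 : C l (r - 2))
    (hC : ∀ x y, (C' (rev l r x) (rev l r y) ∨ C' (rev l r y) (rev l r x)) ↔ (C x y ∨ C y x)) :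
    kirchhoff (Gg N C) < kirchhoff (Gg N C') := by
  rw [← kirchhoff_comap (Gg N C') Gg_conn (sg N l r (by omega))]
  refine switch (Hg N C l r) _ _ Gg_conn
    (Finset.univ.filter fun x : Fin N => (x : ℕ) < l ∨ r + 3 ≤ x)
    (Finset.univ.filter fun x : Fin N => l ≤ (x : ℕ) ∧ (x : ℕ) ≤ r - 2)
    ⟨l - 1, by omega⟩ ⟨r + 3, by omega⟩ ⟨r + 2, by omega⟩ ⟨r + 1, by omega⟩
    ⟨l, by omega⟩ ⟨r - 2, by omega⟩ ⟨r - 1, by omega⟩ ⟨r, by omega⟩ ?_ ?_ ?_ ?_ ?_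
  · refine ⟨?_, ?_, ?_, ?_, ?_, ?_, ?_, ?_, ?_, ?_, ?_⟩
    · simp; omega
    · simp
    · simp; omega
    · simp; omega
    · simp
    · intro x hx y hxy
      simp only [Finset.mem_filter, Finset.mem_univ, true_and, Hg_adj, Fin.ext_iff] at *
      obtain ⟨hne, h | h | h⟩ := hxy
      · omega
      · have := hC1 _ _ h
        omega
      · have := hC1 _ _ h
        omega
    · intro y
      have c1 : ¬ C (r + 2) y := fun h => by
        have := hC1 _ _ h
        omega
      have c2 : ¬ C y (r + 2) := fun h => by
        have := hC1 _ _ h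
        omega
      have := y.2
      simp only [Hg_adj, Fin.ext_iff, c1, c2, or_false]
      omega
    · intro y
      have c1 : ¬ C (r + 1) y := fun h => by
        have := hC1 _ _ h
        omega
      have c2 : ¬ C y (r + 1) := fun h => by
        have := hC1 _ _ h
        omega
      have := y.2
      simp only [Hg_adj, Fin.ext_iff, c1, c2, or_false]
      omega
    · rw [Hg_adj]
      exact ⟨by show l - 1 ≠ r + 3; omega, Or.inr (Or.inl hC2)⟩
    · intro x hx
      simp only [Finset.mem_filter, Finset.mem_univ, true_and] at hx
      refine Hg_out (by omega) hl (by omega) (by omega) _ _ (by omega) (Or.inl ?_)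
      show l - 1 < l
      omega
    · refine le_trans ?_ (card_out N l (r + 3) (by omega) (by omega))
      omega
  · refine ⟨?_, ?_, ?_, ?_, ?_, ?_, ?_, ?_, ?_, ?_, ?_⟩
    · simp; omega
    · simp; omega
    · simp; omega
    · simp; omega
    · simp; omega
    · intro x hx y hxy
      simp only [Finset.mem_filter, Finset.mem_univ, true_and, Hg_adj, Fin.ext_iff] at *
      obtain ⟨hne, h | h | h⟩ := hxy
      · omega
      · have := hC1 _ _ h
        omega
      · have := hC1 _ _ h
        omega
    · intro y
      have c1 : ¬ C (r - 1) y := fun h => by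
        have := hC1 _ _ h
        omega
      have c2 : ¬ C y (r - 1) := fun h => by
        have := hC1 _ _ h
        omega
      have := y.2
      simp only [Hg_adj, Fin.ext_iff, c1, c2, or_false]
      omega
    · intro y
      have c1 : ¬ C r y := fun h => by
        have := hC1 _ _ h
        omega
      have c2 : ¬ C y r := fun h => by
        have := hC1 _ _ h
        omega
      have := y.2
      simp only [Hg_adj, Fin.ext_iff, c1, c2, or_false]
      omega
    · rw [Hg_adj]
      exact ⟨by show l ≠ r - 2; omega, Or.inr (Or.inl hC3)⟩
    · intro x hx
      simp only [Finset.mem_filter, Finset.mem_univ, true_and] at hx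
      refine Hg_in _ _ (by omega) ⟨?_, ?_⟩
      · show l ≤ l
        omega
      · show l ≤ r
        omega
    · refine le_trans ?_ (card_in N l (r - 2) (by omega))
      omega
  · intro x hx hy
    simp only [Finset.mem_filter, Finset.mem_univ, true_and, Fin.ext_iff] at hx hy
    omega
  · rw [Gg_eq (l := l) (r := r) hl (by omega) (by omega), SimpleGraph.edge_comm (⟨r, by omega⟩ : Fin N)]
  · rw [Gg_comap hl (by omega) (by omega) hC, SimpleGraph.edge_comm (⟨l, by omega⟩ : Fin N)]

lemma main4 (N : ℕ) (C C' : ℕ → ℕ → Prop) (l r : ℕ) (hl : 3 ≤ l)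
    (hrN : r + 1 < N) (hcA : 8 ≤ (l - 2) + (N - (r + 1))) (hcB : l + 9 ≤ r)
    (hC1 : ∀ x y, C x y → (x + 3 ≤ l ∧ r + 1 ≤ y) ∨ (l + 2 ≤ x ∧ y ≤ r ∧ x < y))
    (hC2 : C (l - 3) (r + 1)) (hC3 : C (l + 2) r)
    (hC : ∀ x y, (C' (rev l r x) (rev l r y) ∨ C' (rev l r y) (rev l r x)) ↔ (C x y ∨ C y x)) :
    kirchhoff (Gg N C) < kirchhoff (Gg N C') := by
  rw [← kirchhoff_comap (Gg N C') Gg_conn (sg N l r (by omega))]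
  refine switch (Hg N C l r) _ _ Gg_conn
    (Finset.univ.filter fun x : Fin N => (x : ℕ) < l - 2 ∨ r + 1 ≤ x)
    (Finset.univ.filter fun x : Fin N => l + 2 ≤ (x : ℕ) ∧ (x : ℕ) ≤ r)
    ⟨r + 1, by omega⟩ ⟨l - 3, by omega⟩ ⟨l - 2, by omega⟩ ⟨l - 1, by omega⟩
    ⟨r, by omega⟩ ⟨l + 2, by omega⟩ ⟨l + 1, by omega⟩ ⟨l, by omega⟩ ?_ ?_ ?_ ?_ ?_
  · refine ⟨?_, ?_, ?_, ?_, ?_, ?_, ?_, ?_, ?_, ?_, ?_⟩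
    · simp only [Finset.mem_filter, Finset.mem_univ, true_and]
      omega
    · simp only [Finset.mem_filter, Finset.mem_univ, true_and]
      omega
    · simp only [Finset.mem_filter, Finset.mem_univ, true_and]
      omega
    · simp only [Finset.mem_filter, Finset.mem_univ, true_and]
      omega
    · simp only [ne_eq, Fin.ext_iff]
      omega
    · intro x hx y hxy
      simp only [Finset.mem_filter, Finset.mem_univ, true_and, Hg_adj, Fin.ext_iff] at *
      obtain ⟨hne, h | h | h⟩ := hxy
      · omega
      · have := hC1 _ _ h
        omega
      · have := hC1 _ _ h
        omega
    · intro y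
      have c1 : ¬ C (l - 2) y := fun h => by
        have := hC1 _ _ h
        omega
      have c2 : ¬ C y (l - 2) := fun h => by
        have := hC1 _ _ h
        omega
      have := y.2
      simp only [Hg_adj, Fin.ext_iff, c1, c2, or_false]
      omega
    · intro y
      have c1 : ¬ C (l - 1) y := fun h => by
        have := hC1 _ _ h
        omega
      have c2 : ¬ C y (l - 1) := fun h => by
        have := hC1 _ _ h
        omega
      have := y.2
      simp only [Hg_adj, Fin.ext_iff, c1, c2, or_false]
      omega
    · rw [Hg_adj]
      exact ⟨by show r + 1 ≠ l - 3; omega, Or.inr (Or.inr hC2)⟩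
    · intro x hx
      simp only [Finset.mem_filter, Finset.mem_univ, true_and] at hx
      refine Hg_out (by omega) (by omega) (by omega) (by omega) _ _ (by omega) (Or.inr ?_)
      show r < r + 1
      omega
    · refine le_trans ?_ (card_out N (l - 2) (r + 1) (by omega) (by omega))
      omega
  · refine ⟨?_, ?_, ?_, ?_, ?_, ?_, ?_, ?_, ?_, ?_, ?_⟩
    · simp only [Finset.mem_filter, Finset.mem_univ, true_and]
      omega
    · simp only [Finset.mem_filter, Finset.mem_univ, true_and]
      omega
    · simp only [Finset.mem_filter, Finset.mem_univ, true_and]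
      omega
    · simp only [Finset.mem_filter, Finset.mem_univ, true_and]
      omega
    · simp only [ne_eq, Fin.ext_iff]
      omega
    · intro x hx y hxy
      simp only [Finset.mem_filter, Finset.mem_univ, true_and, Hg_adj, Fin.ext_iff] at *
      obtain ⟨hne, h | h | h⟩ := hxy
      · omega
      · have := hC1 _ _ h
        omega
      · have := hC1 _ _ h
        omega
    · intro y
      have c1 : ¬ C (l + 1) y := fun h => by
        have := hC1 _ _ h
        omega
      have c2 : ¬ C y (l + 1) := fun h => by
        have := hC1 _ _ h
        omega
      have := y.2
      simp only [Hg_adj, Fin.ext_iff, c1, c2, or_false]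
      omega
    · intro y
      have c1 : ¬ C l y := fun h => by
        have := hC1 _ _ h
        omega
      have c2 : ¬ C y l := fun h => by
        have := hC1 _ _ h
        omega
      have := y.2
      simp only [Hg_adj, Fin.ext_iff, c1, c2, or_false]
      omega
    · rw [Hg_adj]
      exact ⟨by show r ≠ l + 2; omega, Or.inr (Or.inr hC3)⟩
    · intro x hx
      simp only [Finset.mem_filter, Finset.mem_univ, true_and] at hx
      refine Hg_in _ _ (by omega) ⟨?_, ?_⟩
      · show l ≤ r
        omega
      · show r ≤ r
        omega
    · refine le_trans ?_ (card_in N (l + 2) r (by omega))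
      omega
  · intro x hx hy
    simp only [Finset.mem_filter, Finset.mem_univ, true_and, Fin.ext_iff] at hx hy
    omega
  · rw [Gg_eq (l := l) (r := r) (by omega) (by omega) (by omega),
      SimpleGraph.edge_comm (⟨r, by omega⟩ : Fin N), sup_right_comm]
  · rw [Gg_comap (by omega) (by omega) (by omega) hC,
      SimpleGraph.edge_comm (⟨l, by omega⟩ : Fin N), sup_right_comm]

lemma chord_flip (n K l r : ℕ) (t b t' b' : ℕ → ℕ)
    (f1 : ∀ k, 1 ≤ k → k ≤ K → t k < l ∧ r < b k ∧ t' k = t k ∧ b' k = b k)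
    (f2 : ∀ k, K < k → k ≤ n - 1 → l ≤ t k ∧ t k < b k ∧ b k ≤ r ∧ t' k + b k = l + r ∧
      b' k + t k = l + r) (x y : ℕ) :
    ((∃ k, 1 ≤ k ∧ k ≤ n - 1 ∧ rev l r x = t' k ∧ rev l r y = b' k) ∨
      (∃ k, 1 ≤ k ∧ k ≤ n - 1 ∧ rev l r y = t' k ∧ rev l r x = b' k)) ↔
    ((∃ k, 1 ≤ k ∧ k ≤ n - 1 ∧ x = t k ∧ y = b k) ∨
      (∃ k, 1 ≤ k ∧ k ≤ n - 1 ∧ y = t k ∧ x = b k)) := by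
  have fwd : ∀ x y, (∃ k, 1 ≤ k ∧ k ≤ n - 1 ∧ x = t k ∧ y = b k) →
      ((∃ k, 1 ≤ k ∧ k ≤ n - 1 ∧ rev l r x = t' k ∧ rev l r y = b' k) ∨
      (∃ k, 1 ≤ k ∧ k ≤ n - 1 ∧ rev l r y = t' k ∧ rev l r x = b' k)) := by
    rintro x y ⟨k, k1, k2, hx, hy⟩
    rcases Nat.lt_or_ge K k with h | h
    · have := f2 k h k2
      refine Or.inr ⟨k, k1, k2, ?_, ?_⟩ <;> unfold rev <;> split_ifs <;> omega
    · have := f1 k k1 h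
      refine Or.inl ⟨k, k1, k2, ?_, ?_⟩ <;> unfold rev <;> split_ifs <;> omega
  have bwd : ∀ x y, (∃ k, 1 ≤ k ∧ k ≤ n - 1 ∧ rev l r x = t' k ∧ rev l r y = b' k) →
      ((∃ k, 1 ≤ k ∧ k ≤ n - 1 ∧ x = t k ∧ y = b k) ∨
      (∃ k, 1 ≤ k ∧ k ≤ n - 1 ∧ y = t k ∧ x = b k)) := by
    rintro x y ⟨k, k1, k2, hx, hy⟩
    have ex := rev_rev l r x
    have ey := rev_rev l r y
    rw [hx] at ex
    rw [hy] at ey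
    rcases Nat.lt_or_ge K k with h | h
    · have := f2 k h k2
      refine Or.inr ⟨k, k1, k2, ?_, ?_⟩
      · rw [← ey]; unfold rev; split_ifs <;> omega
      · rw [← ex]; unfold rev; split_ifs <;> omega
    · have := f1 k k1 h
      refine Or.inl ⟨k, k1, k2, ?_, ?_⟩
      · rw [← ex]; unfold rev; split_ifs <;> omega
      · rw [← ey]; unfold rev; split_ifs <;> omega
  constructor
  · rintro (h | h)
    · exact bwd x y h
    · exact (bwd y x h).symm
  · rintro (h | h)
    · exact fwd x y h
    · exact (fwd y x h).symm

lemma tpos_one (n : ℕ) (w : Fin (n - 2) → Fin 5) : tpos n w 1 = 1 := by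
  unfold tpos
  rw [Finset.sum_eq_zero]
  · rfl
  · intro j hj
    simp at hj

lemma tpos_succ (n : ℕ) (w : Fin (n - 2) → Fin 5) (j : Fin (n - 2)) :
    tpos n w ((j : ℕ) + 2) = tpos n w ((j : ℕ) + 1) + 1 + (w j : ℕ) := by
  unfold tpos
  have e : (Finset.univ.filter fun a : Fin (n - 2) => (a : ℕ) + 1 < (j : ℕ) + 2) =
      insert j (Finset.univ.filter fun a : Fin (n - 2) => (a : ℕ) + 1 < (j : ℕ) + 1) := by
    ext a
    simp only [Finset.mem_filter, Finset.mem_univ, true_and, Finset.mem_insert, Fin.ext_iff]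
    omega
  rw [e, Finset.sum_insert (by simp)]
  omega

lemma bpos_eq (n : ℕ) (w : Fin (n - 2) → Fin 5) (k : ℕ) (k1 : 1 ≤ k) (k2 : k ≤ n - 1) :
    bpos n w k = tpos n w k + 6 * (n - k) + 1 := by
  unfold bpos tpos
  have h1 := Finset.sum_filter_add_sum_filter_not Finset.univ
    (fun j : Fin (n - 2) => (j : ℕ) + 1 < k) (fun j => (w j : ℕ))
  simp only [not_lt] at h1
  have h2 : ∑ j ∈ Finset.univ.filter (fun j : Fin (n - 2) => k ≤ (j : ℕ) + 1), (5 - (w j : ℕ)) +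
      ∑ j ∈ Finset.univ.filter (fun j : Fin (n - 2) => k ≤ (j : ℕ) + 1), (w j : ℕ) =
      5 * (n - 1 - k) := by
    rw [← Finset.sum_add_distrib, Finset.sum_congr rfl (g := fun _ => 5)
      (fun j _ => by have := (w j).2; omega), Finset.sum_const, smul_eq_mul, mul_comm]
    congr 1
    rw [← Finset.card_map Fin.valEmbedding]
    have : (Finset.univ.filter (fun j : Fin (n - 2) => k ≤ (j : ℕ) + 1)).map Fin.valEmbedding =
        Finset.Ico (k - 1) (n - 2) := by
      ext x
      simp only [Finset.mem_map, Finset.mem_filter, Finset.mem_univ, true_and, Finset.mem_Ico,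
        Fin.valEmbedding_apply]
      constructor
      · rintro ⟨a, ha, rfl⟩
        have := a.2
        omega
      · rintro ⟨h, h'⟩
        exact ⟨⟨x, h'⟩, by show k ≤ x + 1; omega, rfl⟩
    rw [this, Nat.card_Ico]
    omega
  omega

lemma tpos_le (n : ℕ) (w : Fin (n - 2) → Fin 5) (j : ℕ) (j1 : 1 ≤ j) (d : ℕ) (hd : j + d ≤ n - 1) :
    tpos n w j + d ≤ tpos n w (j + d) ∧ tpos n w (j + d) ≤ tpos n w j + 5 * d := by
  induction d with
  | zero => simp
  | succ d ih =>
    have h1 := ih (by omega)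
    have h2 := tpos_succ n w ⟨j + d - 1, by omega⟩
    have h3 := (w ⟨j + d - 1, by omega⟩).2
    simp only [show j + d - 1 + 2 = j + (d + 1) by omega,
      show j + d - 1 + 1 = j + d by omega] at h2
    omega

lemma oct_eq (n : ℕ) (w : Fin (n - 2) → Fin 5) : octChain n w = Gg (6 * n + 2)
    (fun x y => ∃ k, 1 ≤ k ∧ k ≤ n - 1 ∧ x = tpos n w k ∧ y = bpos n w k) := by
  unfold octChain Gg
  congr 1
  funext a b
  have : ((a : ℕ) + 1 = 6 * n + 2) = ((a : ℕ) = 6 * n + 1) := by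
    apply propext; omega
  rw [this]

lemma main (n : ℕ) (w w' : Fin (n - 2) → Fin 5) (i : Fin (n - 2)) (hi : w i = 0 ∨ w i = 4)
    (h1 : ∀ j : Fin (n - 2), (j : ℕ) < i → w' j = w j) (h2 : (w' i : ℕ) = 2)
    (h3 : ∀ j : Fin (n - 2), (i : ℕ) < j → (w' j : ℕ) = 4 - (w j : ℕ)) :
    kirchhoff (octChain n w) < kirchhoff (octChain n w') := by
  have hin := i.2
  have g1 : ∀ k, k ≤ (i : ℕ) + 1 → tpos n w' k = tpos n w k := by
    intro k hk
    unfold tpos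
    congr 1
    refine Finset.sum_congr rfl fun j hj => ?_
    simp only [Finset.mem_filter, Finset.mem_univ, true_and] at hj
    rw [h1 j (by omega)]
  have s1 := tpos_succ n w i
  have s2 := tpos_succ n w' i
  rw [h2, g1 _ le_rfl] at s2
  have g2 : ∀ d, (i : ℕ) + 2 + d ≤ n - 1 → tpos n w' ((i : ℕ) + 2 + d) + tpos n w ((i : ℕ) + 2 + d)
      = tpos n w' ((i : ℕ) + 2) + tpos n w ((i : ℕ) + 2) + 6 * d := by
    intro d
    induction d with
    | zero => intro _; rfl
    | succ d ih =>
      intro hd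
      have e := ih (by omega)
      have e1 := tpos_succ n w ⟨(i : ℕ) + 1 + d, by omega⟩
      have e2 := tpos_succ n w' ⟨(i : ℕ) + 1 + d, by omega⟩
      have e3 := h3 ⟨(i : ℕ) + 1 + d, by omega⟩ (by show (i : ℕ) < (i : ℕ) + 1 + d; omega)
      have e4 := (w ⟨(i : ℕ) + 1 + d, by omega⟩).2
      simp only [show (i : ℕ) + 1 + d + 2 = (i : ℕ) + 2 + (d + 1) by omega,
        show (i : ℕ) + 1 + d + 1 = (i : ℕ) + 2 + d by omega] at e1 e2
      omega
  have B := bpos_eq n w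
  have B' := bpos_eq n w'
  have lo : ∀ k, 1 ≤ k → k ≤ (i : ℕ) + 1 → tpos n w k ≤ tpos n w ((i : ℕ) + 1) ∧
      bpos n w ((i : ℕ) + 1) ≤ bpos n w k ∧ tpos n w' k = tpos n w k ∧ bpos n w' k = bpos n w k := by
    intro k k1 k2
    have e := tpos_le n w k k1 ((i : ℕ) + 1 - k) (by omega)
    rw [show k + ((i : ℕ) + 1 - k) = (i : ℕ) + 1 by omega] at e
    have b1 := B k k1 (by omega)
    have b2 := B ((i : ℕ) + 1) (by omega) (by omega)
    have b3 := B' k k1 (by omega)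
    have := g1 k k2
    omega
  have hi2 : ∀ k, (i : ℕ) + 1 < k → k ≤ n - 1 → tpos n w ((i : ℕ) + 2) ≤ tpos n w k ∧
      tpos n w k < bpos n w k ∧ bpos n w k ≤ bpos n w ((i : ℕ) + 2) ∧
      tpos n w' k + bpos n w k = tpos n w' ((i : ℕ) + 2) + bpos n w ((i : ℕ) + 2) ∧
      bpos n w' k + tpos n w k = tpos n w' ((i : ℕ) + 2) + bpos n w ((i : ℕ) + 2) := by
    intro k k1 k2
    have e := tpos_le n w ((i : ℕ) + 2) (by omega) (k - ((i : ℕ) + 2)) (by omega)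
    have e' := g2 (k - ((i : ℕ) + 2)) (by omega)
    rw [show (i : ℕ) + 2 + (k - ((i : ℕ) + 2)) = k by omega] at e e'
    have b1 := B k (by omega) (by omega)
    have b2 := B ((i : ℕ) + 2) (by omega) (by omega)
    have b3 := B' k (by omega) (by omega)
    omega
  have t1 := (lo 1 le_rfl (by omega)).1
  rw [tpos_one] at t1
  have bK := B ((i : ℕ) + 1) (by omega) (by omega)
  have bK1 := B ((i : ℕ) + 2) (by omega) (by omega)
  have tK := tpos_le n w 1 le_rfl (i : ℕ) (by omega)
  rw [tpos_one, Nat.add_comm 1 (i : ℕ)] at tK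
  have ex1 : ∃ k, 1 ≤ k ∧ k ≤ n - 1 ∧ tpos n w ((i : ℕ) + 1) = tpos n w k ∧
    bpos n w ((i : ℕ) + 1) = bpos n w k := ⟨(i : ℕ) + 1, by omega, by omega, rfl, rfl⟩
  have ex2 : ∃ k, 1 ≤ k ∧ k ≤ n - 1 ∧ tpos n w ((i : ℕ) + 2) = tpos n w k ∧
    bpos n w ((i : ℕ) + 2) = bpos n w k := ⟨(i : ℕ) + 2, by omega, by omega, rfl, rfl⟩
  rw [oct_eq, oct_eq]
  rcases hi with hi | hi
  · have hi' : (w i : ℕ) = 0 := by rw [hi]; rfl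
    refine main0 (6 * n + 2) _ _ (tpos n w ((i : ℕ) + 2)) (bpos n w ((i : ℕ) + 2) + 2)
      (by omega) (by omega) (by omega) (by omega) ?_ ?_ ?_ ?_
    · rintro x y ⟨k, k1, k2, rfl, rfl⟩
      rcases Nat.lt_or_ge ((i : ℕ) + 1) k with h | h
      · have := hi2 k h k2
        omega
      · have := lo k k1 h
        omega
    · convert ex1 using 6 <;> omega
    · convert ex2 using 6 <;> omega
    · refine chord_flip n ((i : ℕ) + 1) _ _ _ _ _ _ ?_ ?_
      · intro k k1 k2
        have := lo k k1 k2
        omega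
      · intro k k1 k2
        have := hi2 k k1 k2
        omega
  · have hi' : (w i : ℕ) = 4 := by rw [hi]; rfl
    refine main4 (6 * n + 2) _ _ (tpos n w ((i : ℕ) + 1) + 3) (bpos n w ((i : ℕ) + 2))
      (by omega) (by omega) (by omega) (by omega) ?_ ?_ ?_ ?_
    · rintro x y ⟨k, k1, k2, rfl, rfl⟩
      rcases Nat.lt_or_ge ((i : ℕ) + 1) k with h | h
      · have := hi2 k h k2
        omega
      · have := lo k k1 h
        omega
    · convert ex1 using 6 <;> omega
    · convert ex2 using 6 <;> omega
    · refine chord_flip n ((i : ℕ) + 1) _ _ _ _ _ _ ?_ ?_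
      · intro k k1 k2
        have := lo k k1 k2
        omega
      · intro k k1 k2
        have := hi2 k k1 k2
        omega

end Oct

/-- Lemma 5 of the paper. If `w_i = 0` or `w_i = 4` for some `i`, and
`w' = (w_1,…,w_{i-1}, 2, 4-w_{i+1},…,4-w_{n-2})`, then `Kf(O(w)) < Kf(O(w'))`. -/
theorem kirchhoff_lt_of_kink_to_two (n : ℕ) (hn : 3 ≤ n) (w : Fin (n - 2) → Fin 5)
    (i : Fin (n - 2)) (hi : w i = 0 ∨ w i = 4) :
    kirchhoff (octChain n w) <
      kirchhoff (octChain n (fun j => if (j : ℕ) < (i : ℕ) then w j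
        else if j = i then (2 : Fin 5) else ⟨4 - (w j : ℕ), by omega⟩)) := by
  refine Oct.main n w _ i hi ?_ ?_ ?_
  · intro j hj
    simp only [if_pos hj]
  · simp
  · intro j hj
    have hne : j ≠ i := fun e => by rw [e] at hj; omega
    simp only [if_neg (show ¬ (j : ℕ) < (i : ℕ) by omega), if_neg hne]
end
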